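/- Fix n ≥ 1, m ≥ 1, T > 0, and x₀ ∈ ℝⁿ. Let f : ℝⁿ × ℝ^m → ℝⁿ and r : ℝⁿ × ℝ^m → ℝ be twice continuously differentiable jointly in (x, β), with f(·, β) globally Lipschitz for every β, and let q : ℝⁿ → ℝ be twice continuously differentiable. Let ᾱ ∈ {0,1}^m, and suppose that for every β in some neighborhood of ᾱ in ℝ^m there is a function x^β : ℝ → ℝⁿ with x^β(0) = x₀ and (x^β)'(t) = f(x^β(t), β) for all t ∈ [0,T]; write x̄ := x^ᾱ. Let λ : ℝ → ℝⁿ solve the adjoint system λ(T) = ∇q(x̄(T)) and λ'(t) = −(∂f/∂x(x̄(t), ᾱ))ᵀ λ(t) − ∇_x r(x̄(t), ᾱ) for all t ∈ [0,T]. Define J(β) := ∫₀ᵀ r(x^β(t), β) dt + q(x^β(T)). Then for each i ∈ {1,…,m}, the limit lim_{ε → 0} ( J(ᾱ + ε e_i) − J(ᾱ) )/ε exists and equals ∫₀ᵀ [ ⟨ ∂f/∂β_i (x̄(t), ᾱ), λ(t) ⟩ + ∂r/∂β_i (x̄(t), ᾱ) ] dt, where e_i is the i-th standard basis vector of ℝ^m.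 -/

import Mathlib

open scoped RealInnerProductSpace

/-- A `C²` map on a proper space is Lipschitz, with a uniform quadratic bound on the first-order
Taylor remainder, on every closed ball around the origin. -/
theorem ContDiff.exists_lipschitz_taylor_bound_closedBall {E F : Type*}
    [NormedAddCommGroup E] [NormedSpace ℝ E] [ProperSpace E]
    [NormedAddCommGroup F] [NormedSpace ℝ F] {g : E → F} (hg : ContDiff ℝ 2 g) (R : ℝ) :
    ∃ C : ℝ, 0 ≤ C ∧ ∀ x ∈ Metric.closedBall (0 : E) R, ∀ y ∈ Metric.closedBall (0 : E) R,
      ‖g y - g x‖ ≤ C * ‖y - x‖ ∧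
      ‖g y - g x - fderiv ℝ g x (y - x)‖ ≤ C * ‖y - x‖ ^ 2 := by
  have hg' : ContDiff ℝ 1 (fderiv ℝ g) := hg.fderiv_right (by norm_num)
  have hK := isCompact_closedBall (0 : E) R
  have hconv := convex_closedBall (0 : E) R
  obtain ⟨C₁, hC₁⟩ := hK.exists_bound_of_continuousOn hg'.continuous.continuousOn
  obtain ⟨C₂, hC₂⟩ := hK.exists_bound_of_continuousOn
    (hg'.continuous_fderiv one_ne_zero).continuousOn
  refine ⟨max 0 (max C₁ C₂), le_max_left _ _, fun x hx y hy => ⟨?_, ?_⟩⟩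
  · exact hconv.norm_image_sub_le_of_norm_fderiv_le
      (fun z _ => hg.differentiable (by norm_num) z)
      (fun z hz => (hC₁ z hz).trans ((le_max_left _ _).trans (le_max_right _ _))) hx hy
  · rw [pow_two, ← mul_assoc]
    refine (hconv.inter (convex_closedBall x ‖y - x‖)).norm_image_sub_le_of_norm_fderiv_le'
      (fun z _ => hg.differentiable (by norm_num) z) (fun z hz => ?_)
      ⟨hx, Metric.mem_closedBall_self (norm_nonneg _)⟩ ⟨hy, by simp [dist_eq_norm]⟩
    have hz' : ‖z - x‖ ≤ ‖y - x‖ := by simpa [dist_eq_norm] using hz.2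
    calc ‖fderiv ℝ g z - fderiv ℝ g x‖ ≤ max 0 (max C₁ C₂) * ‖z - x‖ :=
          hconv.norm_image_sub_le_of_norm_fderiv_le
            (fun w _ => hg'.differentiable one_ne_zero w)
            (fun w hw => (hC₂ w hw).trans ((le_max_right _ _).trans (le_max_right _ _))) hx hz.1
      _ ≤ _ := by gcongr

/-- The partial derivatives of a jointly differentiable map sum up to its derivative. -/
theorem DifferentiableAt.fderiv_uncurry_apply {E P F : Type*}
    [NormedAddCommGroup E] [NormedSpace ℝ E] [NormedAddCommGroup P] [NormedSpace ℝ P]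
    [NormedAddCommGroup F] [NormedSpace ℝ F] {g : E → P → F} {x : E} {b : P}
    (hg : DifferentiableAt ℝ (fun p : E × P => g p.1 p.2) (x, b)) (v : E) (w : P) :
    fderiv ℝ (fun p : E × P => g p.1 p.2) (x, b) (v, w) =
      fderiv ℝ (fun y => g y b) x v + fderiv ℝ (fun c => g x c) b w := by
  have h₁ : HasFDerivAt (fun y => g y b) _ x :=
    hg.hasFDerivAt.comp (f := fun y : E => (y, b)) x (hasFDerivAt_prodMk_left x b)
  have h₂ : HasFDerivAt (fun c => g x c) _ b :=
    hg.hasFDerivAt.comp (f := fun c : P => (x, c)) b (hasFDerivAt_prodMk_right x b)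
  rw [h₁.fderiv, h₂.fderiv]
  simp [← map_add]

/-- Lipschitz dependence of trajectories on parameters, uniformly on a compact time interval. -/
theorem eventually_norm_trajectory_sub_le {E P : Type*}
    [NormedAddCommGroup E] [NormedSpace ℝ E] [ProperSpace E]
    [NormedAddCommGroup P] [NormedSpace ℝ P] [ProperSpace P] {f : E → P → E}
    (hf : ContDiff ℝ 2 (fun p : E × P => f p.1 p.2)) {T : ℝ} (hT : 0 ≤ T) {x₀ : E} {a : P}
    {X : P → ℝ → E} {U : Set P} (hU : U ∈ nhds a) (hX0 : ∀ b ∈ U, X b 0 = x₀)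
    (hX : ∀ b ∈ U, ∀ t ∈ Set.Icc (0 : ℝ) T, HasDerivAt (X b) (f (X b t) b) t) :
    ∃ C : ℝ, 0 ≤ C ∧ ∀ᶠ b in nhds a, ∀ t ∈ Set.Icc (0 : ℝ) T,
      ‖X b t - X a t‖ ≤ C * ‖b - a‖ := by
  have ha : a ∈ U := mem_of_mem_nhds hU
  have hcont : ∀ b ∈ U, ContinuousOn (X b) (Set.Icc 0 T) := fun b hb t ht =>
    (hX b hb t ht).continuousAt.continuousWithinAt
  obtain ⟨M, hM⟩ := isCompact_Icc.exists_bound_of_continuousOn (hcont a ha)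
  obtain ⟨L, hL0, hL⟩ := hf.exists_lipschitz_taylor_bound_closedBall (max M ‖a‖ + 1)
  set A := Real.exp ((2 * L + 1) * T)
  have hA : 0 < A := Real.exp_pos _
  have hA1 : 1 ≤ A := Real.one_le_exp (by positivity)
  refine ⟨A, hA.le, ?_⟩
  filter_upwards [hU, Metric.ball_mem_nhds a (inv_pos.2 hA)] with b hb hball
  rcases eq_or_ne b a with rfl | hne
  · simp
  have hpos : 0 < ‖b - a‖ := norm_pos_iff.2 (sub_ne_zero.2 hne)
  have hsmall : A * ‖b - a‖ ≤ 1 := by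
    rw [mem_ball_iff_norm] at hball
    calc A * ‖b - a‖ ≤ A * A⁻¹ := by gcongr
      _ = 1 := mul_inv_cancel₀ hA.ne'
  have hsmall' : ‖b - a‖ ≤ 1 := le_trans (by nlinarith) hsmall
  set B : ℝ → ℝ := fun t => ‖b - a‖ * Real.exp ((2 * L + 1) * t)
  have hB : ∀ t, HasDerivAt B (‖b - a‖ * (Real.exp ((2 * L + 1) * t) * (2 * L + 1))) t :=
    fun t => (((hasDerivAt_id t).const_mul (2 * L + 1)).exp.const_mul ‖b - a‖).congr_deriv
      (by simp)
  have hBle : ∀ t ∈ Set.Icc (0 : ℝ) T, B t ≤ A * ‖b - a‖ := fun t ht => by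
    rw [mul_comm A]
    exact mul_le_mul_of_nonneg_left
      (Real.exp_le_exp.2 (mul_le_mul_of_nonneg_left ht.2 (by positivity))) hpos.le
  intro t ht
  refine le_trans (image_norm_le_of_norm_deriv_right_lt_deriv_boundary
    (f := fun s => X b s - X a s) (f' := fun s => f (X b s) b - f (X a s) a)
    ((hcont b hb).sub (hcont a ha))
    (fun s hs => ((hX b hb s (Set.Ico_subset_Icc_self hs)).sub
      (hX a ha s (Set.Ico_subset_Icc_self hs))).hasDerivWithinAt)
    (by simp [hX0 b hb, hX0 a ha, B]) hB (fun s hs heq => ?_) ht) (hBle t ht)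
  have hs' := Set.Ico_subset_Icc_self hs
  have hXa := hM s hs'
  have hle : ‖X b s - X a s‖ ≤ 1 := heq.le.trans ((hBle s hs').trans hsmall)
  have hXb : ‖X b s‖ ≤ ‖X a s‖ + ‖X b s - X a s‖ := by
    simpa using norm_add_le (X a s) (X b s - X a s)
  have hbn : ‖b‖ ≤ ‖a‖ + ‖b - a‖ := by simpa using norm_add_le a (b - a)
  have hM1 := le_max_left M ‖a‖
  have hM2 := le_max_right M ‖a‖
  have key := (hL (X a s, a) (by
      rw [mem_closedBall_zero_iff, Prod.norm_mk]
      exact max_le (by linarith) (by linarith)) (X b s, b) (by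
      rw [mem_closedBall_zero_iff, Prod.norm_mk]
      exact max_le (by linarith) (by linarith))).1
  have hexp : 1 ≤ Real.exp ((2 * L + 1) * s) :=
    Real.one_le_exp (mul_nonneg (by positivity) hs.1)
  have hdom : ‖((X b s, b) : E × P) - (X a s, a)‖ ≤ B s := by
    rw [Prod.mk_sub_mk, Prod.norm_mk]
    exact max_le heq.le (le_mul_of_one_le_right hpos.le hexp)
  have hBpos : 0 < B s := mul_pos hpos (Real.exp_pos _)
  calc ‖f (X b s) b - f (X a s) a‖ ≤ L * B s :=
        key.trans (mul_le_mul_of_nonneg_left hdom hL0)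
    _ < B s * (2 * L + 1) := by nlinarith
    _ = _ := mul_assoc _ _ _

/-- First-order expansion of the payoff of a parametrized control problem, written through the
adjoint state, with a quadratic remainder. -/
theorem exists_payoff_adjoint_expansion {E P : Type*}
    [NormedAddCommGroup E] [InnerProductSpace ℝ E] [ProperSpace E]
    [NormedAddCommGroup P] [NormedSpace ℝ P] [ProperSpace P]
    {f : E → P → E} {r : E → P → ℝ} {q : E → ℝ}
    (hf : ContDiff ℝ 2 (fun p : E × P => f p.1 p.2))
    (hr : ContDiff ℝ 2 (fun p : E × P => r p.1 p.2)) (hq : ContDiff ℝ 2 q)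
    {T : ℝ} (hT : 0 ≤ T) {x₀ : E} {a : P}
    {X : P → ℝ → E} {U : Set P} (hU : U ∈ nhds a) (hX0 : ∀ b ∈ U, X b 0 = x₀)
    (hX : ∀ b ∈ U, ∀ t ∈ Set.Icc (0 : ℝ) T, HasDerivAt (X b) (f (X b t) b) t)
    {lam : ℝ → E} (hlamT : lam T = gradient q (X a T))
    (hlam : ∀ t ∈ Set.Icc (0 : ℝ) T, HasDerivAt lam
      (-(ContinuousLinearMap.adjoint (fderiv ℝ (fun x => f x a) (X a t)) (lam t))
        - gradient (fun x => r x a) (X a t)) t) :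
    ∃ C : ℝ, ∀ᶠ b in nhds a,
      ‖((∫ t in (0 : ℝ)..T, r (X b t) b) + q (X b T))
        - ((∫ t in (0 : ℝ)..T, r (X a t) a) + q (X a T))
        - ∫ t in (0 : ℝ)..T, (⟪fderiv ℝ (fun c => f (X a t) c) a (b - a), lam t⟫
            + fderiv ℝ (fun c => r (X a t) c) a (b - a))‖ ≤ C * ‖b - a‖ ^ 2 := by
  have ha : a ∈ U := mem_of_mem_nhds hU
  have hcont : ∀ b ∈ U, ContinuousOn (X b) (Set.Icc 0 T) := fun b hb t ht =>
    (hX b hb t ht).continuousAt.continuousWithinAt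
  have hlamc : ContinuousOn lam (Set.Icc 0 T) := fun t ht =>
    (hlam t ht).continuousAt.continuousWithinAt
  obtain ⟨M, hM⟩ := isCompact_Icc.exists_bound_of_continuousOn (hcont a ha)
  obtain ⟨N, hN⟩ := isCompact_Icc.exists_bound_of_continuousOn hlamc
  have hN0 : 0 ≤ N := (norm_nonneg _).trans (hN 0 (Set.left_mem_Icc.2 hT))
  obtain ⟨D, hD0, hD⟩ := eventually_norm_trajectory_sub_le hf hT hU hX0 hX
  set R := max M ‖a‖ + D + 1
  have hRM : M + D ≤ R := by linarith [le_max_left M ‖a‖]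
  have hRa : ‖a‖ + 1 ≤ R := by linarith [le_max_right M ‖a‖]
  obtain ⟨Cf, hCf0, hCf⟩ := hf.exists_lipschitz_taylor_bound_closedBall R
  obtain ⟨Cr, hCr0, hCr⟩ := hr.exists_lipschitz_taylor_bound_closedBall R
  obtain ⟨Cq, hCq0, hCq⟩ := hq.exists_lipschitz_taylor_bound_closedBall R
  have hfd := hf.differentiable two_ne_zero
  have hrd := hr.differentiable two_ne_zero
  refine ⟨(Cr + Cf * N) * (D + 1) ^ 2 * T + Cq * D ^ 2, ?_⟩
  filter_upwards [hU, hD, Metric.ball_mem_nhds a one_pos] with b hb hDb hball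
  rw [mem_ball_iff_norm] at hball
  have hbn : ‖b‖ ≤ ‖a‖ + ‖b - a‖ := by simpa using norm_add_le a (b - a)
  have hXaR : ∀ t ∈ Set.Icc (0 : ℝ) T, ‖X a t‖ ≤ R := fun t ht => by linarith [hM t ht]
  have hXbR : ∀ t ∈ Set.Icc (0 : ℝ) T, ‖X b t‖ ≤ R := fun t ht => by
    have h : ‖X b t‖ ≤ ‖X a t‖ + ‖X b t - X a t‖ := by
      simpa using norm_add_le (X a t) (X b t - X a t)
    nlinarith [hM t ht, hDb t ht]
  have hadj : ∀ t ∈ Set.Icc (0 : ℝ) T, HasDerivAt (fun s => ⟪lam s, X b s - X a s⟫)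
      (⟪lam t, f (X b t) b - f (X a t) a - fderiv ℝ (fun x => f x a) (X a t) (X b t - X a t)⟫
        - fderiv ℝ (fun x => r x a) (X a t) (X b t - X a t)) t := fun t ht => by
    refine ((hlam t ht).inner ℝ ((hX b hb t ht).sub (hX a ha t ht))).congr_deriv ?_
    simp only [inner_sub_left, inner_neg_left, ContinuousLinearMap.adjoint_inner_left,
      inner_gradient_left, inner_sub_right, map_sub, Pi.sub_apply]
    ring
  set ρ : ℝ → ℝ := fun t => r (X b t) b - r (X a t) a
    - fderiv ℝ (fun p : E × P => r p.1 p.2) (X a t, a) (X b t - X a t, b - a)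
    + ⟪lam t, f (X b t) b - f (X a t) a
      - fderiv ℝ (fun p : E × P => f p.1 p.2) (X a t, a) (X b t - X a t, b - a)⟫ with hρ
  have hρle : ∀ t ∈ Set.Icc (0 : ℝ) T, ‖ρ t‖ ≤ (Cr + Cf * N) * (D + 1) ^ 2 * ‖b - a‖ ^ 2 := by
    intro t ht
    have h₁ : ((X a t, a) : E × P) ∈ Metric.closedBall 0 R := by
      rw [mem_closedBall_zero_iff, Prod.norm_mk]
      exact max_le (hXaR t ht) (by linarith)
    have h₂ : ((X b t, b) : E × P) ∈ Metric.closedBall 0 R := by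
      rw [mem_closedBall_zero_iff, Prod.norm_mk]
      exact max_le (hXbR t ht) (by linarith)
    have hdiff : ‖((X b t, b) : E × P) - (X a t, a)‖ ≤ (D + 1) * ‖b - a‖ := by
      rw [Prod.mk_sub_mk, Prod.norm_mk]
      exact max_le (by linarith [hDb t ht, norm_nonneg (b - a)])
        (le_mul_of_one_le_left (norm_nonneg _) (by linarith))
    have hdiff2 : ‖((X b t, b) : E × P) - (X a t, a)‖ ^ 2 ≤ (D + 1) ^ 2 * ‖b - a‖ ^ 2 := by
      rw [← mul_pow]
      gcongr
    have hrt := (hCr _ h₁ _ h₂).2.trans (mul_le_mul_of_nonneg_left hdiff2 hCr0)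
    have hft := (hCf _ h₁ _ h₂).2.trans (mul_le_mul_of_nonneg_left hdiff2 hCf0)
    calc ‖ρ t‖ ≤ Cr * ((D + 1) ^ 2 * ‖b - a‖ ^ 2) + N * (Cf * ((D + 1) ^ 2 * ‖b - a‖ ^ 2)) :=
          (norm_add_le _ _).trans (add_le_add hrt ((norm_inner_le_norm _ _).trans
            (mul_le_mul (hN t ht) hft (norm_nonneg _) hN0)))
      _ = _ := by ring
  have hXbc := hcont b hb
  have hXac := hcont a ha
  have hpac : ContinuousOn (fun t => ((X a t, a) : E × P)) (Set.Icc 0 T) :=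
    hXac.prodMk continuousOn_const
  have hpbc : ContinuousOn (fun t => ((X b t, b) : E × P)) (Set.Icc 0 T) :=
    hXbc.prodMk continuousOn_const
  have hfac : ContinuousOn (fun t => f (X a t) a) (Set.Icc 0 T) :=
    hf.continuous.comp_continuousOn hpac
  have hfbc : ContinuousOn (fun t => f (X b t) b) (Set.Icc 0 T) :=
    hf.continuous.comp_continuousOn hpbc
  have hrac : ContinuousOn (fun t => r (X a t) a) (Set.Icc 0 T) :=
    hr.continuous.comp_continuousOn hpac
  have hrbc : ContinuousOn (fun t => r (X b t) b) (Set.Icc 0 T) :=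
    hr.continuous.comp_continuousOn hpbc
  have hDfc := (hf.continuous_fderiv two_ne_zero).comp_continuousOn hpac
  have hDrc := (hr.continuous_fderiv two_ne_zero).comp_continuousOn hpac
  have hδc := hXbc.sub hXac
  have hfx : ∀ (t : ℝ) (v : E), fderiv ℝ (fun x => f x a) (X a t) v =
      fderiv ℝ (fun p : E × P => f p.1 p.2) (X a t, a) (v, 0) := fun t v => by
    rw [(hfd _).fderiv_uncurry_apply, map_zero, add_zero]
  have hrx : ∀ (t : ℝ) (v : E), fderiv ℝ (fun x => r x a) (X a t) v =
      fderiv ℝ (fun p : E × P => r p.1 p.2) (X a t, a) (v, 0) := fun t v => by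
    rw [(hrd _).fderiv_uncurry_apply, map_zero, add_zero]
  have hfb : ∀ (t : ℝ) (w : P), fderiv ℝ (fun c => f (X a t) c) a w =
      fderiv ℝ (fun p : E × P => f p.1 p.2) (X a t, a) (0, w) := fun t w => by
    rw [(hfd _).fderiv_uncurry_apply, map_zero, zero_add]
  have hrb : ∀ (t : ℝ) (w : P), fderiv ℝ (fun c => r (X a t) c) a w =
      fderiv ℝ (fun p : E × P => r p.1 p.2) (X a t, a) (0, w) := fun t w => by
    rw [(hrd _).fderiv_uncurry_apply, map_zero, zero_add]
  have hadjc : ContinuousOn (fun t => ⟪lam t, f (X b t) b - f (X a t) a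
      - fderiv ℝ (fun x => f x a) (X a t) (X b t - X a t)⟫
      - fderiv ℝ (fun x => r x a) (X a t) (X b t - X a t)) (Set.Icc 0 T) := by
    simp only [hfx, hrx]
    exact (hlamc.inner ((hfbc.sub hfac).sub
      (hDfc.clm_apply (hδc.prodMk continuousOn_const)))).sub
      (hDrc.clm_apply (hδc.prodMk continuousOn_const))
  have hmainc : ContinuousOn (fun t => ⟪fderiv ℝ (fun c => f (X a t) c) a (b - a), lam t⟫
      + fderiv ℝ (fun c => r (X a t) c) a (b - a)) (Set.Icc 0 T) := by
    simp only [hfb, hrb]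
    exact ((hDfc.clm_apply continuousOn_const).inner hlamc).add
      (hDrc.clm_apply continuousOn_const)
  have hint : ∀ {u : ℝ → ℝ}, ContinuousOn u (Set.Icc 0 T) →
      IntervalIntegrable u MeasureTheory.volume 0 T :=
    fun hu => hu.intervalIntegrable_of_Icc hT
  have hdiffint : IntervalIntegrable (fun t => r (X b t) b - r (X a t) a)
      MeasureTheory.volume 0 T := hint (hrbc.sub hrac)
  have hsumint : IntervalIntegrable (fun t => r (X b t) b - r (X a t) a
      + (⟪lam t, f (X b t) b - f (X a t) a
        - fderiv ℝ (fun x => f x a) (X a t) (X b t - X a t)⟫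
      - fderiv ℝ (fun x => r x a) (X a t) (X b t - X a t))) MeasureTheory.volume 0 T :=
    hdiffint.add (hint hadjc)
  have hftc := intervalIntegral.integral_eq_sub_of_hasDerivAt
    (fun t ht => hadj t (by rwa [Set.uIcc_of_le hT] at ht)) (hint hadjc)
  have hρint : ∫ t in (0 : ℝ)..T, ρ t = (∫ t in (0 : ℝ)..T, r (X b t) b)
      - (∫ t in (0 : ℝ)..T, r (X a t) a) + ⟪lam T, X b T - X a T⟫
      - ∫ t in (0 : ℝ)..T, (⟪fderiv ℝ (fun c => f (X a t) c) a (b - a), lam t⟫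
            + fderiv ℝ (fun c => r (X a t) c) a (b - a)) := by
    have h0 : ⟪lam T, X b T - X a T⟫ = ⟪lam T, X b T - X a T⟫ - ⟪lam 0, X b 0 - X a 0⟫ := by
      simp [hX0 b hb, hX0 a ha]
    rw [h0, ← hftc, ← intervalIntegral.integral_sub (hint hrbc) (hint hrac),
      ← intervalIntegral.integral_add hdiffint (hint hadjc),
      ← intervalIntegral.integral_sub hsumint (hint hmainc)]
    refine intervalIntegral.integral_congr fun t _ => ?_
    simp only [hρ, (hfd _).fderiv_uncurry_apply, (hrd _).fderiv_uncurry_apply, inner_sub_right,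
      inner_add_right, real_inner_comm (lam t)]
    ring
  have hTmem : T ∈ Set.Icc (0 : ℝ) T := Set.right_mem_Icc.2 hT
  have hqle : ‖q (X b T) - q (X a T) - fderiv ℝ q (X a T) (X b T - X a T)‖
      ≤ Cq * D ^ 2 * ‖b - a‖ ^ 2 := by
    rw [mul_assoc, ← mul_pow]
    refine (hCq _ (mem_closedBall_zero_iff.2 (hXaR T hTmem)) _
      (mem_closedBall_zero_iff.2 (hXbR T hTmem))).2.trans ?_
    gcongr
    exact hDb T hTmem
  have hρbound : ‖∫ t in (0 : ℝ)..T, ρ t‖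
      ≤ (Cr + Cf * N) * (D + 1) ^ 2 * ‖b - a‖ ^ 2 * |T - 0| :=
    intervalIntegral.norm_integral_le_of_norm_le_const fun t ht =>
      hρle t (Set.Ioc_subset_Icc_self (by rwa [Set.uIoc_of_le hT] at ht))
  rw [sub_zero, abs_of_nonneg hT] at hρbound
  rw [hlamT, inner_gradient_left] at hρint
  calc _ = ‖(∫ t in (0 : ℝ)..T, ρ t)
        + (q (X b T) - q (X a T) - fderiv ℝ q (X a T) (X b T - X a T))‖ := by
          rw [hρint]
          congr 1
          ring
    _ ≤ _ := norm_add_le_of_le hρbound hqle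
    _ = _ := by ring

/-- Adjoint-based formula for the standard derivative: with a family of
trajectories `X β` of `x' = f(x, β)` defined near `ᾱ`, payoff
`J(β) = ∫₀ᵀ r(X β t, β) dt + q(X β T)`, and adjoint state `lam`, the difference
quotient `(J(ᾱ + ε e_i) − J(ᾱ))/ε` tends (as `ε → 0`) to
`∫₀ᵀ (⟪∂f/∂β_i(x̄, ᾱ), lam⟫ + ∂r/∂β_i(x̄, ᾱ)) dt`. -/
theorem stmt_9 (n m : ℕ) (hn : 1 ≤ n) (hm : 1 ≤ m) (T : ℝ) (hT : 0 < T)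
    (x₀ : EuclideanSpace ℝ (Fin n))
    (f : EuclideanSpace ℝ (Fin n) → EuclideanSpace ℝ (Fin m) →
      EuclideanSpace ℝ (Fin n))
    (r : EuclideanSpace ℝ (Fin n) → EuclideanSpace ℝ (Fin m) → ℝ)
    (q : EuclideanSpace ℝ (Fin n) → ℝ)
    (hf : ContDiff ℝ 2 (fun p : EuclideanSpace ℝ (Fin n) × EuclideanSpace ℝ (Fin m)
      => f p.1 p.2))
    (hr : ContDiff ℝ 2 (fun p : EuclideanSpace ℝ (Fin n) × EuclideanSpace ℝ (Fin m)
      => r p.1 p.2))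
    (hq : ContDiff ℝ 2 q)
    (hfLip : ∀ β : EuclideanSpace ℝ (Fin m), ∃ K : NNReal,
      LipschitzWith K (fun x => f x β))
    (ᾱ : EuclideanSpace ℝ (Fin m)) (hᾱ : ∀ i, ᾱ i = 0 ∨ ᾱ i = 1)
    (X : EuclideanSpace ℝ (Fin m) → ℝ → EuclideanSpace ℝ (Fin n))
    (U : Set (EuclideanSpace ℝ (Fin m))) (hU : U ∈ nhds ᾱ)
    (hX0 : ∀ β ∈ U, X β 0 = x₀)
    (hXode : ∀ β ∈ U, ∀ t ∈ Set.Icc (0 : ℝ) T, HasDerivAt (X β) (f (X β t) β) t)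
    (lam : ℝ → EuclideanSpace ℝ (Fin n))
    (hlamT : lam T = gradient q (X ᾱ T))
    (hlam : ∀ t ∈ Set.Icc (0 : ℝ) T, HasDerivAt lam
      (-(ContinuousLinearMap.adjoint (fderiv ℝ (fun x => f x ᾱ) (X ᾱ t)) (lam t))
        - gradient (fun x => r x ᾱ) (X ᾱ t)) t)
    (J : EuclideanSpace ℝ (Fin m) → ℝ)
    (hJ : ∀ β, J β = (∫ t in (0 : ℝ)..T, r (X β t) β) + q (X β T))
    (i : Fin m) :
    Filter.Tendsto
      (fun ε : ℝ => (J (ᾱ + ε • EuclideanSpace.single i (1 : ℝ)) - J ᾱ) / ε)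
      (nhdsWithin 0 {(0 : ℝ)}ᶜ)
      (nhds (∫ t in (0 : ℝ)..T,
        (⟪fderiv ℝ (fun β => f (X ᾱ t) β) ᾱ (EuclideanSpace.single i (1 : ℝ)),
            lam t⟫
          + fderiv ℝ (fun β => r (X ᾱ t) β) ᾱ (EuclideanSpace.single i (1 : ℝ))))) := by
  obtain ⟨C, hC⟩ := exists_payoff_adjoint_expansion hf hr hq hT.le hU hX0 hXode hlamT hlam
  set e : EuclideanSpace ℝ (Fin m) := EuclideanSpace.single i (1 : ℝ)
  have hlim : Filter.Tendsto (fun ε : ℝ => ᾱ + ε • e) (nhds 0) (nhds ᾱ) := by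
    have : Continuous fun ε : ℝ => ᾱ + ε • e := by fun_prop
    simpa using this.tendsto 0
  have hbound : Filter.Tendsto (fun ε : ℝ => C * ‖e‖ ^ 2 * |ε|)
      (nhdsWithin 0 {(0 : ℝ)}ᶜ) (nhds 0) := by
    have : Continuous fun ε : ℝ => C * ‖e‖ ^ 2 * |ε| := by fun_prop
    simpa using (this.tendsto 0).mono_left nhdsWithin_le_nhds
  refine tendsto_iff_norm_sub_tendsto_zero.2
    (squeeze_zero' (Filter.Eventually.of_forall fun _ => norm_nonneg _) ?_ hbound)
  filter_upwards [self_mem_nhdsWithin, nhdsWithin_le_nhds (hlim.eventually hC)] with ε hε h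
  have hε0 : ε ≠ 0 := hε
  simp only [add_sub_cancel_left, map_smul, real_inner_smul_left, smul_eq_mul, ← mul_add,
    intervalIntegral.integral_const_mul, ← hJ, norm_smul] at h
  refine le_of_mul_le_mul_left ?_ (norm_pos_iff.2 hε0)
  rw [← norm_mul, mul_sub, mul_div_cancel₀ _ hε0]
  refine h.trans_eq ?_
  rw [Real.norm_eq_abs]
  ring
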